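/- Let G be a graph of maximum degree at most d, let B ⊆ V(G) with |B| ≤ s, let r, m ∈ ℕ, and let C₁,...,Cₙ ⊆ V(G) be sets each of size at least g(m,r,s) := (mn + s)·(B(d,r)+1), where B(d,r) := 1 + d + ... + d^r. Then one can choose elements c¹_j,...,c^m_j ∈ C_j for each 1 ≤ j ≤ n such that all chosen elements are pairwise at distance greater than r from each other and each is at distance greater than r from every element of B. -/

import Mathlib

open SimpleGraph Finset

lemma walk_sphere_card {V : Type*} [Fintype V] [DecidableEq V]
    (G : SimpleGraph V) (d : ℕ) (hdeg : ∀ v : V, (G.neighborSet v).ncard ≤ d) (i : ℕ) (v : V) :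
    ∃ S : Finset V, S.card ≤ d ^ i ∧ ∀ u, ∀ p : G.Walk v u, p.length = i → u ∈ S := by
  classical
  induction i generalizing v with
  | zero =>
    refine ⟨{v}, by simp, fun u p hp => ?_⟩
    have := SimpleGraph.Walk.eq_of_length_eq_zero hp
    simp [this]
  | succ k ih =>
    choose S hS hS' using ih
    refine ⟨(G.neighborFinset v).biUnion S, ?_, ?_⟩
    · have h1 : (G.neighborFinset v).card ≤ d := by
        have := hdeg v
        rwa [← SimpleGraph.coe_neighborFinset, Set.ncard_coe_finset] at this
      calc _ ≤ (G.neighborFinset v).card * d ^ k := Finset.card_biUnion_le_card_mul _ _ _ fun x _ => hS x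
        _ ≤ d * d ^ k := Nat.mul_le_mul_right _ h1
        _ = d ^ (k + 1) := by ring
    · intro u p hp
      cases p with
      | nil => simp at hp
      | cons h q =>
        simp only [SimpleGraph.Walk.length_cons, Nat.add_right_cancel_iff] at hp
        exact Finset.mem_biUnion.2 ⟨_, by simpa using h, hS' _ _ q hp⟩

lemma walk_ball_card {V : Type*} [Fintype V] [DecidableEq V]
    (G : SimpleGraph V) (d r : ℕ) (hdeg : ∀ v : V, (G.neighborSet v).ncard ≤ d) (v : V) :
    ∃ S : Finset V, S.card ≤ ∑ i ∈ Finset.range (r + 1), d ^ i ∧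
      ∀ u, ∀ p : G.Walk v u, p.length ≤ r → u ∈ S := by
  choose S hS hS' using walk_sphere_card G d hdeg
  refine ⟨(Finset.range (r + 1)).biUnion fun i => S i v, ?_, ?_⟩
  · exact Finset.card_biUnion_le.trans (Finset.sum_le_sum fun i _ => hS i v)
  · intro u p hp
    exact Finset.mem_biUnion.2 ⟨p.length, by simp; omega, hS' _ _ _ p rfl⟩

lemma greedy_scattered {V ι : Type*} [DecidableEq V] [Fintype ι] [DecidableEq ι]
    (G : SimpleGraph V) (r s K : ℕ) (S : V → Finset V) (hS : ∀ v, (S v).card ≤ K)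
    (hS' : ∀ v u, ∀ p : G.Walk v u, p.length ≤ r → u ∈ S v)
    (B : Finset V) (hB : B.card ≤ s) (C : ι → Finset V)
    (hC : ∀ j, (Fintype.card ι + s) * (K + 1) ≤ (C j).card) (T : Finset ι) :
    ∃ c : ι → V, (∀ j, c j ∈ C j) ∧
      (∀ j ∈ T, ∀ j' ∈ T, j ≠ j' → ∀ p : G.Walk (c j) (c j'), r < p.length) ∧
      (∀ j ∈ T, ∀ b ∈ B, ∀ p : G.Walk (c j) b, r < p.length) := by
  induction T using Finset.induction_on with
  | empty =>
    have : ∀ j, ∃ x, x ∈ C j := fun j => by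
      have h0 : 0 < Fintype.card ι := Fintype.card_pos_iff.2 ⟨j⟩
      exact Finset.card_pos.1 (lt_of_lt_of_le (by positivity) (hC j))
    choose c hc using this
    exact ⟨c, hc, by simp, by simp⟩
  | insert a T ha ih =>
    obtain ⟨c, hc, h1, h2⟩ := ih
    have hT : T.card < Fintype.card ι := Finset.card_lt_univ_of_notMem ha
    have hlt : ((B ∪ T.image c).biUnion S).card < (C a).card := by
      have e1 : (B ∪ T.image c).card ≤ s + T.card :=
        (Finset.card_union_le _ _).trans (Nat.add_le_add hB Finset.card_image_le)
      have e2 := Finset.card_biUnion_le_card_mul (B ∪ T.image c) S K fun x _ => hS x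
      have e3 := Nat.mul_le_mul_right K e1
      have e4 := hC a
      nlinarith
    obtain ⟨x, hx, hxn⟩ := Finset.exists_mem_notMem_of_card_lt_card hlt
    have key : ∀ y ∈ B ∪ T.image c, ∀ p : G.Walk y x, r < p.length := by
      intro y hy p
      by_contra hp
      exact hxn (Finset.mem_biUnion.2 ⟨y, hy, hS' _ _ p (by omega)⟩)
    have key' : ∀ y ∈ B ∪ T.image c, ∀ p : G.Walk x y, r < p.length := by
      intro y hy p
      simpa using key y hy p.reverse
    have hcT : ∀ j ∈ T, c j ∈ B ∪ T.image c := fun j hj =>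
      Finset.mem_union_right _ (Finset.mem_image_of_mem c hj)
    have hne : ∀ j ∈ T, Function.update c a x j = c j := fun j hj =>
      Function.update_of_ne (by rintro rfl; exact ha hj) _ _
    have hself : Function.update c a x a = x := Function.update_self _ _ _
    refine ⟨Function.update c a x, ?_, ?_, ?_⟩
    · intro j
      by_cases h : j = a
      · subst h; rwa [hself]
      · rw [Function.update_of_ne h]; exact hc j
    · intro j hj j' hj' hjj
      rcases Finset.mem_insert.1 hj with e | hj
      · rcases Finset.mem_insert.1 hj' with e' | hj'
        · exact absurd (e.trans e'.symm) hjj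
        · rw [e, hself, hne _ hj']
          exact key' _ (hcT _ hj')
      · rcases Finset.mem_insert.1 hj' with e' | hj'
        · rw [e', hself, hne _ hj]
          exact key _ (hcT _ hj)
        · rw [hne _ hj, hne _ hj']
          exact h1 j hj j' hj' hjj
    · intro j hj b hb
      rcases Finset.mem_insert.1 hj with e | hj
      · subst e
        rw [hself]
        exact key' _ (Finset.mem_union_left _ hb)
      · rw [hne _ hj]
        exact h2 j hj b hb

/-- In a graph `G` of maximum degree at most `d`, given a set `B` with
`|B| ≤ s` and sets `C₁, …, Cₙ` each of size at least `g(m,r,s) = (m·n + s)·(B(d,r)+1)`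
(where `B(d,r) = 1 + d + ⋯ + d^r`), one can choose `m` elements from each `C_j` such that
all chosen elements are pairwise at distance greater than `r`, and each is at distance
greater than `r` from every element of `B`. -/
theorem scattered_representatives {V : Type*} [Fintype V] [DecidableEq V]
    (G : SimpleGraph V) (d r m s n : ℕ)
    (hdeg : ∀ v : V, (G.neighborSet v).ncard ≤ d)
    (B : Finset V) (hB : B.card ≤ s)
    (C : Fin n → Finset V)
    (hC : ∀ j, (m * n + s) * ((∑ i ∈ Finset.range (r + 1), d ^ i) + 1) ≤ (C j).card) :
    ∃ c : Fin n → Fin m → V,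
      (∀ j i, c j i ∈ C j) ∧
      (∀ j i j' i', (j, i) ≠ (j', i') →
        ∀ p : G.Walk (c j i) (c j' i'), r < p.length) ∧
      (∀ j i, ∀ b ∈ B, ∀ p : G.Walk (c j i) b, r < p.length) := by
  choose S hS hS' using walk_ball_card G d r hdeg
  obtain ⟨c, h0, h1, h2⟩ := greedy_scattered (ι := Fin n × Fin m) G r s _ S hS hS' B hB
    (fun j => C j.1) (fun j => by simpa [mul_comm n m] using hC j.1) Finset.univ
  exact ⟨fun j i => c (j, i), fun j i => h0 (j, i),
    fun j i j' i' h => h1 _ (Finset.mem_univ _) _ (Finset.mem_univ _) h,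
    fun j i => h2 _ (Finset.mem_univ _)⟩
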